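/- Let s ∈ ℂ with Re s > 0 and let R > 0. Let (ω_n)_{n≥1} be a sequence of complex numbers with Σ_{n≥1} √(1+n²)|ω_n|² < ∞. Then the series Σ_{n≥1} (K_n'(sR)/K_n(sR)) |ω_n|² converges absolutely and -Re( Σ_{n=1}^∞ (K_n'(sR)/K_n(sR)) |ω_n|² ) ≥ 0. -/

import Mathlib

open MeasureTheory

/-- The modified Bessel function of the second kind,
`K_ν(z) = ∫₀^∞ e^{-z cosh t} cosh(ν t) dt`, for `Re z > 0`. -/
noncomputable def besselK (ν : ℝ) (z : ℂ) : ℂ :=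
  ∫ t in Set.Ioi (0 : ℝ), Complex.exp (-z * Real.cosh t) * (Real.cosh (ν * t) : ℂ)

/-- The derivative of the modified Bessel function of the second kind,
`K_ν'(z) = -∫₀^∞ e^{-z cosh t} cosh t cosh(ν t) dt`, for `Re z > 0`. -/
noncomputable def besselK' (ν : ℝ) (z : ℂ) : ℂ :=
  -∫ t in Set.Ioi (0 : ℝ),
      Complex.exp (-z * Real.cosh t) * (Real.cosh t : ℂ) * (Real.cosh (ν * t) : ℂ)


lemma bk_decay (σ k : ℝ) (hσ : 0 < σ) :
    ∃ C : ℝ, 0 ≤ C ∧ ∀ t : ℝ, 0 ≤ t → Real.exp (-σ * Real.cosh t) * Real.exp (k * t) ≤ C * Real.exp (-t) := by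
  obtain ⟨m, hm⟩ := exists_nat_ge (k + 1)
  refine ⟨m.factorial * (2 / σ) ^ m, by positivity, fun t ht => ?_⟩
  set x := σ * Real.exp t / 2 with hx
  have hxpos : 0 < x := by positivity
  have h1 : Real.exp (-σ * Real.cosh t) ≤ Real.exp (-x) := by
    apply Real.exp_le_exp.mpr
    rw [Real.cosh_eq, hx]
    nlinarith [Real.exp_pos (-t), mul_pos hσ (Real.exp_pos (-t))]
  have h2 := Real.pow_div_factorial_le_exp x hxpos.le m
  have h3 : Real.exp (-x) ≤ m.factorial * (2 / σ) ^ m * Real.exp (-(m * t)) := by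
    rw [Real.exp_neg, inv_le_comm₀ (Real.exp_pos _) (by positivity)]
    refine le_trans (le_of_eq ?_) h2
    rw [hx, Real.exp_neg, Real.exp_nat_mul]
    simp only [div_pow, mul_pow]
    field_simp
  calc Real.exp (-σ * Real.cosh t) * Real.exp (k * t)
      ≤ (m.factorial * (2 / σ) ^ m * Real.exp (-(m * t))) * Real.exp (k * t) := by
        gcongr; exact h1.trans h3
    _ = m.factorial * (2 / σ) ^ m * Real.exp (-(m * t) + k * t) := by
        rw [Real.exp_add]; ring
    _ ≤ _ := by
        gcongr
        nlinarith

lemma bk_cosh_le (x : ℝ) : Real.cosh x ≤ Real.exp |x| := by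
  rw [← Real.cosh_abs, Real.cosh_eq]
  have : Real.exp (-|x|) ≤ Real.exp |x| := Real.exp_le_exp.mpr (by linarith [abs_nonneg x])
  linarith

lemma bk_sinh_le (x : ℝ) : |Real.sinh x| ≤ Real.exp |x| := by
  refine le_trans ?_ (bk_cosh_le x)
  rw [Real.sinh_eq, Real.cosh_eq, abs_le]
  constructor <;> linarith [Real.exp_pos x, Real.exp_pos (-x)]

lemma bk_norm (z : ℂ) (t p : ℝ) :
    ‖Complex.exp (-z * Real.cosh t) * (p : ℂ)‖ = Real.exp (-z.re * Real.cosh t) * |p| := by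
  rw [norm_mul, Complex.norm_exp, Complex.norm_real, Real.norm_eq_abs]
  congr 2
  rw [Complex.re_mul_ofReal, Complex.neg_re]

lemma bk_integrable (z : ℂ) (hz : 0 < z.re) (k : ℝ) (p : ℝ → ℝ) (hp : Continuous p)
    (hb : ∀ t, 0 ≤ t → |p t| ≤ Real.exp (k * t)) :
    IntegrableOn (fun t : ℝ => Complex.exp (-z * Real.cosh t) * (p t : ℂ)) (Set.Ioi 0) := by
  obtain ⟨C, hC, h⟩ := bk_decay z.re k hz
  have hI : IntegrableOn (fun t : ℝ => C * Real.exp (-t)) (Set.Ioi 0) :=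
    (integrableOn_exp_neg_Ioi 0).const_mul C
  refine Integrable.mono' hI ?_ ?_
  · apply Continuous.aestronglyMeasurable
    have := Real.continuous_cosh
    fun_prop
  · refine (ae_restrict_iff' measurableSet_Ioi).mpr (Filter.Eventually.of_forall fun t ht => ?_)
    rw [bk_norm]
    have ht' : 0 ≤ t := le_of_lt ht
    refine le_trans ?_ (h t ht')
    gcongr
    exact hb t ht'

lemma bk_cosh_bd (ν t : ℝ) (ht : 0 ≤ t) : |Real.cosh (ν * t)| ≤ Real.exp (|ν| * t) := by
  rw [abs_of_pos (Real.cosh_pos _)]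
  refine (bk_cosh_le _).trans (le_of_eq ?_)
  rw [abs_mul, abs_of_nonneg ht]

lemma bk_sinh_bd (ν t : ℝ) (ht : 0 ≤ t) : |Real.sinh (ν * t)| ≤ Real.exp (|ν| * t) := by
  refine (bk_sinh_le _).trans (le_of_eq ?_)
  rw [abs_mul, abs_of_nonneg ht]

lemma bk_int_c (ν : ℝ) (z : ℂ) (hz : 0 < z.re) :
    IntegrableOn (fun t : ℝ => Complex.exp (-z * Real.cosh t) * (Real.cosh (ν * t) : ℂ)) (Set.Ioi 0) :=
  bk_integrable z hz |ν| (fun t => Real.cosh (ν * t))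
    (Real.continuous_cosh.comp (by fun_prop)) (bk_cosh_bd ν)

lemma bk_int_cc (ν : ℝ) (z : ℂ) (hz : 0 < z.re) :
    IntegrableOn (fun t : ℝ => Complex.exp (-z * Real.cosh t) *
      ((Real.cosh t * Real.cosh (ν * t) : ℝ) : ℂ)) (Set.Ioi 0) := by
  refine bk_integrable z hz (1 + |ν|) (fun t => Real.cosh t * Real.cosh (ν * t))
    (Real.continuous_cosh.mul (Real.continuous_cosh.comp (by fun_prop))) fun t ht => ?_
  have h1 := bk_cosh_bd 1 t ht
  have h2 := bk_cosh_bd ν t ht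
  rw [one_mul, abs_one] at h1
  rw [abs_mul, add_mul, Real.exp_add]
  gcongr

lemma bk_int_ss (ν : ℝ) (z : ℂ) (hz : 0 < z.re) :
    IntegrableOn (fun t : ℝ => Complex.exp (-z * Real.cosh t) *
      ((Real.sinh t * Real.sinh (ν * t) : ℝ) : ℂ)) (Set.Ioi 0) := by
  refine bk_integrable z hz (1 + |ν|) (fun t => Real.sinh t * Real.sinh (ν * t))
    (Real.continuous_sinh.mul (Real.continuous_sinh.comp (by fun_prop))) fun t ht => ?_
  have h1 := bk_sinh_bd 1 t ht
  have h2 := bk_sinh_bd ν t ht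
  rw [one_mul, abs_one] at h1
  rw [abs_mul, add_mul, Real.exp_add]
  gcongr

lemma bk'_eq (ν : ℝ) (z : ℂ) : besselK' ν z = -∫ t in Set.Ioi (0 : ℝ),
    Complex.exp (-z * Real.cosh t) * ((Real.cosh t * Real.cosh (ν * t) : ℝ) : ℂ) := by
  rw [besselK']
  congr 2
  ext t
  push_cast
  ring

lemma bk_ibp (ν : ℝ) (z : ℂ) (hz : 0 < z.re) :
    ν * besselK ν z = z * ∫ t in Set.Ioi (0 : ℝ),
      Complex.exp (-z * Real.cosh t) * ((Real.sinh t * Real.sinh (ν * t) : ℝ) : ℂ) := by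
  have hd : ∀ t ∈ Set.Ici (0 : ℝ), HasDerivAt
      (fun t : ℝ => Complex.exp (-z * Real.cosh t) * (Real.sinh (ν * t) : ℂ))
      (ν * (Complex.exp (-z * Real.cosh t) * (Real.cosh (ν * t) : ℂ)) -
        z * (Complex.exp (-z * Real.cosh t) * ((Real.sinh t * Real.sinh (ν * t) : ℝ) : ℂ))) t := by
    intro t _
    have h1 : HasDerivAt (fun t : ℝ => Complex.exp (-z * Real.cosh t))
        (Complex.exp (-z * Real.cosh t) * (-z * Real.sinh t)) t :=
      (((Real.hasDerivAt_cosh t).ofReal_comp).const_mul (-z)).cexp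
    have h2 : HasDerivAt (fun t : ℝ => Real.sinh (ν * t)) (Real.cosh (ν * t) * (ν * 1)) t :=
      ((hasDerivAt_id t).const_mul ν).sinh
    refine (h1.mul h2.ofReal_comp).congr_deriv ?_
    push_cast
    ring
  have hi := ((bk_int_c ν z hz).const_mul (ν : ℂ)).sub ((bk_int_ss ν z hz).const_mul z)
  have ht : Filter.Tendsto (fun t : ℝ => Complex.exp (-z * Real.cosh t) * (Real.sinh (ν * t) : ℂ))
      Filter.atTop (nhds 0) := by
    obtain ⟨C, hC, h⟩ := bk_decay z.re |ν| hz
    have hl : Filter.Tendsto (fun t : ℝ => C * Real.exp (-t)) Filter.atTop (nhds 0) := by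
      simpa using Real.tendsto_exp_neg_atTop_nhds_zero.const_mul C
    refine squeeze_zero_norm' ?_ hl
    filter_upwards [Filter.eventually_ge_atTop 0] with t ht
    rw [bk_norm]
    refine le_trans ?_ (h t ht)
    gcongr
    exact bk_sinh_bd ν t ht
  have := integral_Ioi_of_hasDerivAt_of_tendsto' hd hi ht
  rw [integral_sub ((bk_int_c ν z hz).const_mul (ν : ℂ)) ((bk_int_ss ν z hz).const_mul z),
    integral_const_mul, integral_const_mul] at this
  simp only [mul_zero, Real.sinh_zero, Complex.ofReal_zero, sub_zero] at this
  rw [besselK]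
  exact sub_eq_zero.mp this

lemma bk_add (ν : ℝ) (z : ℂ) (hz : 0 < z.re) :
    besselK (ν + 1) z = -besselK' ν z + ν / z * besselK ν z := by
  have hz0 : z ≠ 0 := by rintro rfl; simp at hz
  have h := bk_ibp ν z hz
  have : ν / z * besselK ν z = ∫ t in Set.Ioi (0 : ℝ),
      Complex.exp (-z * Real.cosh t) * ((Real.sinh t * Real.sinh (ν * t) : ℝ) : ℂ) := by
    rw [div_mul_eq_mul_div, h]; field_simp
  rw [this, bk'_eq, neg_neg, ← integral_add (bk_int_cc ν z hz) (bk_int_ss ν z hz), besselK]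
  congr 1
  ext t
  rw [add_mul, one_mul, Real.cosh_add]
  push_cast
  ring

lemma bk_sub (ν : ℝ) (z : ℂ) (hz : 0 < z.re) :
    besselK (ν - 1) z = -besselK' ν z - ν / z * besselK ν z := by
  have hz0 : z ≠ 0 := by rintro rfl; simp at hz
  have h := bk_ibp ν z hz
  have : ν / z * besselK ν z = ∫ t in Set.Ioi (0 : ℝ),
      Complex.exp (-z * Real.cosh t) * ((Real.sinh t * Real.sinh (ν * t) : ℝ) : ℂ) := by
    rw [div_mul_eq_mul_div, h]; field_simp
  rw [this, bk'_eq, neg_neg, ← integral_sub (bk_int_cc ν z hz) (bk_int_ss ν z hz), besselK]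
  congr 1
  ext t
  rw [sub_mul, one_mul, Real.cosh_sub]
  push_cast
  ring

lemma bk_bound (ν σ : ℝ) (hσ : 0 < σ) : ∃ M : ℝ, ∀ z : ℂ, σ ≤ z.re →
    ‖besselK ν z‖ ≤ M * Real.exp (-z.re) := by
  refine ⟨Real.exp σ * ∫ t in Set.Ioi (0 : ℝ), ‖Complex.exp (-(σ : ℂ) * Real.cosh t) * (Real.cosh (ν * t) : ℂ)‖,
    fun z hz => ?_⟩
  have hi := (bk_int_c ν σ (by simpa using hσ)).norm
  rw [mul_right_comm, ← Real.exp_add, ← integral_const_mul, besselK]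
  refine norm_integral_le_of_norm_le (hi.const_mul _) (Filter.Eventually.of_forall fun t => ?_)
  rw [bk_norm, bk_norm, ← mul_assoc, ← Real.exp_add, Complex.ofReal_re]
  gcongr
  nlinarith [Real.one_le_cosh t]

lemma bk_hasDerivAt (ν : ℝ) (z : ℂ) (hz : 0 < z.re) :
    HasDerivAt (besselK ν) (besselK' ν z) z := by
  set σ : ℝ := z.re / 2 with hσ
  have hσ0 : 0 < σ := by positivity
  have hs : {w : ℂ | σ < w.re} ∈ nhds z :=
    (isOpen_lt continuous_const Complex.continuous_re).mem_nhds (by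
      show σ < z.re
      linarith)
  have hcc := bk_int_cc ν (σ : ℂ) (by simpa using hσ0)
  have key := hasDerivAt_integral_of_dominated_loc_of_deriv_le
    (μ := volume.restrict (Set.Ioi (0 : ℝ)))
    (F := fun (w : ℂ) (t : ℝ) => Complex.exp (-w * Real.cosh t) * (Real.cosh (ν * t) : ℂ))
    (F' := fun (w : ℂ) (t : ℝ) => -(Complex.exp (-w * Real.cosh t) *
      ((Real.cosh t * Real.cosh (ν * t) : ℝ) : ℂ)))
    (bound := fun t => ‖Complex.exp (-(σ : ℂ) * Real.cosh t) *
      ((Real.cosh t * Real.cosh (ν * t) : ℝ) : ℂ)‖)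
    (x₀ := z) hs ?_ (bk_int_c ν z hz) (bk_int_cc ν z hz).neg.aestronglyMeasurable ?_ hcc.norm ?_
  · have := key.2
    rw [integral_neg, ← bk'_eq] at this
    exact this
  · filter_upwards [hs] with w hw
    exact (bk_int_c ν w (hσ0.trans hw)).aestronglyMeasurable
  · refine Filter.Eventually.of_forall fun t w hw => ?_
    rw [norm_neg, bk_norm, bk_norm, Complex.ofReal_re]
    have hw' : σ < w.re := hw
    gcongr
  · refine Filter.Eventually.of_forall fun t w hw => ?_
    have h1 : HasDerivAt (fun w : ℂ => Complex.exp (-w * Real.cosh t))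
        (Complex.exp (-w * Real.cosh t) * (-1 * Real.cosh t)) w :=
      ((hasDerivAt_id w).neg.mul_const _).cexp
    refine (h1.mul_const _).congr_deriv ?_
    push_cast
    ring

lemma bk'_avg (ν : ℝ) (z : ℂ) (hz : 0 < z.re) :
    besselK' ν z = -(besselK (ν + 1) z + besselK (ν - 1) z) / 2 := by
  rw [bk_add ν z hz, bk_sub ν z hz]; ring

lemma bk'_hasDerivAt (ν : ℝ) (z : ℂ) (hz : 0 < z.re) :
    HasDerivAt (besselK' ν)
      (besselK ν z + ν ^ 2 / z ^ 2 * besselK ν z - besselK' ν z / z) z := by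
  have hz0 : z ≠ 0 := by rintro rfl; simp at hz
  have h := (((bk_hasDerivAt (ν + 1) z hz).add (bk_hasDerivAt (ν - 1) z hz)).neg).div_const 2
  have hev : besselK' ν =ᶠ[nhds z]
      fun w => (-(besselK (ν + 1) + besselK (ν - 1)) : ℂ → ℂ) w / 2 := by
    filter_upwards [(isOpen_lt continuous_const Complex.continuous_re).mem_nhds hz] with w hw
    exact bk'_avg ν w hw
  refine (h.congr_of_eventuallyEq hev).congr_deriv ?_
  have e1 := bk_sub (ν + 1) z hz
  have e2 := bk_add (ν - 1) z hz
  have e3 := bk_add ν z hz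
  have e4 := bk_sub ν z hz
  rw [add_sub_cancel_right] at e1
  rw [sub_add_cancel] at e2
  have f1 : besselK' (ν + 1) z = -besselK ν z - ((ν + 1 : ℝ) : ℂ) / z * besselK (ν + 1) z := by
    rw [e1]; ring
  have f2 : besselK' (ν - 1) z = -besselK ν z + ((ν - 1 : ℝ) : ℂ) / z * besselK (ν - 1) z := by
    rw [e2]; ring
  rw [f1, f2, e3, e4]
  push_cast
  field_simp
  ring

lemma bk_sign (ν : ℝ) (z : ℂ) (hz : 0 < z.re) :
    (besselK' ν z * (starRingEnd ℂ) (besselK ν z)).re ≤ 0 := by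
  have hre : ∀ r : ℝ, (z * r).re = z.re * r := fun r => Complex.re_mul_ofReal z r
  have hpos : ∀ r : ℝ, 1 ≤ r → 0 < (z * r).re := fun r hr => by
    rw [hre]; positivity
  set g : ℝ → ℝ := fun r => ((r : ℂ) * besselK' ν (z * r) * star (besselK ν (z * r))).re with hg
  have hlin : ∀ r : ℝ, HasDerivAt (fun r : ℝ => z * (r : ℂ)) z r := fun r => by
    simpa using (Complex.ofRealCLM.hasDerivAt (x := r)).const_mul z
  have hderiv : ∀ r : ℝ, 1 ≤ r → ∃ d : ℝ, 0 ≤ d ∧ HasDerivAt g d r := by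
    intro r hr
    have hw := hpos r hr
    set w : ℂ := z * r with hwdef
    have hw0 : w ≠ 0 := by intro h; rw [h] at hw; simp at hw
    have hK : HasDerivAt (fun r : ℝ => besselK ν (z * r)) (besselK' ν w * z) r :=
      HasDerivAt.comp (h₂ := besselK ν) (h := fun r : ℝ => z * (r : ℂ)) r (bk_hasDerivAt ν w hw) (hlin r)
    have hK' : HasDerivAt (fun r : ℝ => besselK' ν (z * r))
        ((besselK ν w + ν ^ 2 / w ^ 2 * besselK ν w - besselK' ν w / w) * z) r :=
      HasDerivAt.comp (h₂ := besselK' ν) (h := fun r : ℝ => z * (r : ℂ)) r (bk'_hasDerivAt ν w hw) (hlin r)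
    have hid : HasDerivAt (fun r : ℝ => (r : ℂ)) 1 r := by
      exact (hasDerivAt_id r).ofReal_comp
    have H := (hid.mul hK').mul hK.star
    have H2 := Complex.reCLM.hasFDerivAt.comp_hasDerivAt r H
    refine ⟨_, ?_, H2⟩
    have hr0 : (r : ℂ) ≠ 0 := by
      exact_mod_cast (by linarith : r ≠ 0)
    have hz0 : z ≠ 0 := by rintro rfl; simp at hz
    have heq : (1 * besselK' ν w + (r : ℂ) *
        ((besselK ν w + ν ^ 2 / w ^ 2 * besselK ν w - besselK' ν w / w) * z)) * star (besselK ν w) +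
        (r : ℂ) * besselK' ν w * star (besselK' ν w * z) =
        (w + (ν ^ 2 : ℝ) * w⁻¹) * (Complex.normSq (besselK ν w) : ℂ) +
          (starRingEnd ℂ) w * (Complex.normSq (besselK' ν w) : ℂ) := by
      rw [← Complex.mul_conj, ← Complex.mul_conj]
      simp only [hwdef, map_mul, Complex.conj_ofReal, ← starRingEnd_apply]
      push_cast
      field_simp
      ring
    rw [Complex.reCLM_apply]
    refine le_of_le_of_eq ?_ (congrArg Complex.re heq.symm)
    rw [Complex.add_re, Complex.re_mul_ofReal, Complex.re_mul_ofReal, Complex.add_re,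
      Complex.re_ofReal_mul, Complex.inv_re, Complex.conj_re]
    have := Complex.normSq_nonneg w
    have := Complex.normSq_nonneg (besselK ν w)
    have := Complex.normSq_nonneg (besselK' ν w)
    positivity
  have hmono : MonotoneOn g (Set.Ici 1) := by
    refine monotoneOn_of_deriv_nonneg (convex_Ici 1) ?_ ?_ ?_
    · intro r hr
      obtain ⟨d, _, h⟩ := hderiv r hr
      exact h.continuousAt.continuousWithinAt
    · intro r hr
      rw [interior_Ici] at hr
      obtain ⟨d, _, h⟩ := hderiv r (le_of_lt hr)
      exact h.differentiableAt.differentiableWithinAt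
    · intro r hr
      rw [interior_Ici] at hr
      obtain ⟨d, hd, h⟩ := hderiv r (le_of_lt hr)
      rwa [h.deriv]
  have hlim : Filter.Tendsto g Filter.atTop (nhds 0) := by
    obtain ⟨M, hM⟩ := bk_bound ν z.re hz
    obtain ⟨M1, hM1⟩ := bk_bound (ν + 1) z.re hz
    obtain ⟨M2, hM2⟩ := bk_bound (ν - 1) z.re hz
    have hexp : Filter.Tendsto (fun r : ℝ => (M1 + M2) / 2 * M * (r * Real.exp (-(z.re * r))))
        Filter.atTop (nhds 0) := by
      have := Real.tendsto_pow_mul_exp_neg_atTop_nhds_zero 1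
      have h2 := (this.comp (Filter.tendsto_id.const_mul_atTop hz)).const_mul
        ((M1 + M2) / 2 * M / z.re)
      rw [mul_zero] at h2
      refine h2.congr fun r => ?_
      simp only [Function.comp, id, pow_one]
      field_simp
    refine squeeze_zero_norm' ?_ hexp
    filter_upwards [Filter.eventually_ge_atTop 1] with r hr
    have hw := hpos r hr
    have hle : z.re ≤ (z * r).re := by rw [hre]; nlinarith
    have a := hM _ hle
    have a1 := hM1 _ hle
    have a2 := hM2 _ hle
    have hr0 : 0 ≤ r := by linarith
    set E := Real.exp (-(z * r).re) with hE
    have hE0 : 0 < E := Real.exp_pos _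
    have hE1 : E ≤ 1 := Real.exp_le_one_iff.mpr (by linarith)
    have b : ‖besselK' ν (z * r)‖ ≤ (M1 + M2) / 2 * E := by
      rw [bk'_avg ν _ hw, norm_div, norm_neg]
      have := norm_add_le (besselK (ν + 1) (z * r)) (besselK (ν - 1) (z * r))
      simp only [Complex.norm_ofNat]
      linarith
    have hM0 : 0 ≤ M := by
      have := (norm_nonneg _).trans a
      exact nonneg_of_mul_nonneg_left this hE0
    have hM12 : 0 ≤ (M1 + M2) / 2 := by
      have := (norm_nonneg _).trans b
      exact nonneg_of_mul_nonneg_left this hE0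
    have a' : ‖besselK ν (z * r)‖ ≤ M := a.trans (by nlinarith)
    rw [Real.norm_eq_abs]
    refine (Complex.abs_re_le_norm _).trans ?_
    rw [norm_mul, norm_mul, norm_star, Complex.norm_real, Real.norm_of_nonneg hr0, ← hre]
    calc r * ‖besselK' ν (z * r)‖ * ‖besselK ν (z * r)‖ ≤ r * ((M1 + M2) / 2 * E) * M := by gcongr
      _ = _ := by ring
  have hle : g 1 ≤ 0 := by
    refine ge_of_tendsto hlim ?_
    filter_upwards [Filter.eventually_ge_atTop 1] with r hr
    exact hmono (Set.mem_Ici.mpr le_rfl) (Set.mem_Ici.mpr hr) hr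
  simpa [hg] using hle

lemma bk_ratio_re (ν : ℝ) (z : ℂ) (hz : 0 < z.re) :
    (besselK' ν z / besselK ν z).re ≤ 0 := by
  have h := bk_sign ν z hz
  rw [div_eq_mul_inv, Complex.inv_def, ← mul_assoc, Complex.re_mul_ofReal]
  exact mul_nonpos_of_nonpos_of_nonneg h (inv_nonneg.mpr (Complex.normSq_nonneg _))

lemma bk_prev (ν : ℝ) (z : ℂ) (hz : 0 < z.re) :
    ν * (z⁻¹).re * ‖besselK ν z‖ ≤ ‖besselK (ν + 1) z‖ := by
  have h := bk_sign ν z hz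
  have e : besselK' ν z = ν * z⁻¹ * besselK ν z - besselK (ν + 1) z := by
    rw [bk_add ν z hz]; ring
  rw [e, sub_mul, mul_assoc, Complex.mul_conj, Complex.sub_re, Complex.re_mul_ofReal,
    Complex.re_ofReal_mul, Complex.normSq_eq_norm_sq] at h
  have h2 := (Complex.re_le_norm (besselK (ν + 1) z * (starRingEnd ℂ) (besselK ν z)))
  rw [norm_mul, Complex.norm_conj] at h2
  rcases (norm_nonneg (besselK ν z)).eq_or_lt with h0 | h0
  · rw [← h0]; simp
  · refine le_of_mul_le_mul_right ?_ h0
    nlinarith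

lemma bk_ratio_bound (z : ℂ) (hz : 0 < z.re) : ∃ C : ℝ, ∀ n : ℕ,
    ‖besselK' ((n : ℝ) + 1) z / besselK ((n : ℝ) + 1) z‖ ≤ C * ((n : ℝ) + 1) := by
  have hz0 : z ≠ 0 := by rintro rfl; simp at hz
  have hc : 0 < (z⁻¹).re := by
    rw [Complex.inv_re]; exact div_pos hz (Complex.normSq_pos.mpr hz0)
  set c := (z⁻¹).re with hcdef
  set A := ‖besselK 0 z / besselK 1 z‖ with hA
  refine ⟨A + c⁻¹ + ‖z⁻¹‖, fun n => ?_⟩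
  set ν : ℝ := (n : ℝ) + 1 with hν
  have hν1 : 1 ≤ ν := by simp [hν]
  have hA0 : 0 ≤ A := norm_nonneg _
  have hρ : ‖besselK (ν - 1) z / besselK ν z‖ ≤ A + c⁻¹ := by
    rcases Nat.eq_zero_or_pos n with h0 | h0
    · have : ν = 1 := by simp [hν, h0]
      rw [this, sub_self]
      have := inv_pos.mpr hc
      linarith
    · have h1 : (1 : ℝ) ≤ n := by exact_mod_cast h0
      have hp := bk_prev n z hz
      have : ν - 1 = n := by simp [hν]
      rw [this, norm_div]
      have hb : c * ‖besselK n z‖ ≤ ‖besselK ν z‖ := by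
        refine le_trans ?_ hp
        gcongr
        nlinarith
      have : ‖besselK n z‖ / ‖besselK ν z‖ ≤ c⁻¹ := by
        refine div_le_of_le_mul₀ (norm_nonneg _) (inv_pos.mpr hc).le ?_
        rw [inv_mul_eq_div, le_div_iff₀ hc]
        linarith
      linarith
  by_cases hK : besselK ν z = 0
  · rw [hK, div_zero, norm_zero]; positivity
  · have e : besselK' ν z / besselK ν z = -(besselK (ν - 1) z / besselK ν z) - ν * z⁻¹ := by
      rw [bk_sub ν z hz]; field_simp; ring
    rw [e]
    refine (norm_sub_le _ _).trans ?_
    rw [norm_neg, norm_mul, Complex.norm_real, Real.norm_of_nonneg (by linarith)]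
    have := inv_pos.mpr hc
    nlinarith [norm_nonneg z⁻¹]

/-- Sign property of the s-domain DtN form: if `Σ √(1+n²)|ω_n|² < ∞` (sequence indexed by
`n ≥ 1`, here `n+1` with `n : ℕ`), then the series `Σ (K_n'(sR)/K_n(sR)) |ω_n|²`
converges absolutely and `-Re (Σ_{n≥1} (K_n'(sR)/K_n(sR)) |ω_n|²) ≥ 0`. -/
theorem dtn_form_sign (s : ℂ) (hs : 0 < s.re) (R : ℝ) (hR : 0 < R) (ω : ℕ → ℂ)
    (hω : Summable fun n : ℕ => Real.sqrt (1 + ((n : ℝ) + 1) ^ 2) * ‖ω (n + 1)‖ ^ 2) :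
    (Summable fun n : ℕ =>
      ‖besselK' ((n : ℝ) + 1) (s * R) / besselK ((n : ℝ) + 1) (s * R) *
        ((‖ω (n + 1)‖ : ℂ) ^ 2)‖) ∧
    0 ≤ -(∑' n : ℕ,
        besselK' ((n : ℝ) + 1) (s * R) / besselK ((n : ℝ) + 1) (s * R) *
          ((‖ω (n + 1)‖ : ℂ) ^ 2)).re := by
  have hz : 0 < (s * R).re := by rw [Complex.re_mul_ofReal]; positivity
  obtain ⟨C, hC⟩ := bk_ratio_bound (s * R) hz
  have hC0 : 0 ≤ C := by
    have := (norm_nonneg _).trans (hC 0)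
    simpa using this
  have hsum : Summable fun n : ℕ =>
      ‖besselK' ((n : ℝ) + 1) (s * R) / besselK ((n : ℝ) + 1) (s * R) *
        ((‖ω (n + 1)‖ : ℂ) ^ 2)‖ := by
    refine Summable.of_nonneg_of_le (fun n => norm_nonneg _) (fun n => ?_) (hω.mul_left C)
    rw [norm_mul, norm_pow, Complex.norm_real, norm_norm, ← mul_assoc]
    gcongr
    refine (hC n).trans ?_
    gcongr
    apply Real.le_sqrt_of_sq_le
    linarith
  refine ⟨hsum, ?_⟩
  rw [Complex.re_tsum hsum.of_norm, neg_nonneg]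
  refine tsum_nonpos fun n => ?_
  rw [← Complex.ofReal_pow, Complex.re_mul_ofReal]
  exact mul_nonpos_of_nonpos_of_nonneg (bk_ratio_re _ _ hz) (by positivity)
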